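/- Assume the sl(2)-family setup over K = ℝ. Let b, Λ, k_1, …, k_N be real numbers with b ≠ 0, and let D = {(z, w) ∈ ℝ^N × ℝ : w > z_1 > z_2 > … > z_N}. With φ_1(z,w) = exp(Λw/b²)·∏_j (w − z_j)^{k_j/b²}, define the End(V)-valued functions T_i(z,w) = (φ_1(z,w)/(w − z_i))·Y_i and F(z,w) = ∑_{i=1}^N T_i(z,w). Then for every (z,w) ∈ D and every index i: −b²·(∂F/∂z_i)(z,w) − [ (Λ/2)H_i + ∑_{j≠i} Ω_{ij}/(z_i − z_j), F(z,w) ] = (1/(w − z_i))·F(z,w)∘(k_i·id − H_i) − T_i(z,w)∘( ∑_{j=1}^N (1/(w − z_j))·(k_j·id − H_j) ) + b²·(∂T_i/∂w)(z,w). -/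

import Mathlib

/-!
STATEMENT 18: the key operator identity behind the integral solutions of the
degree-1 irregular KZ equation of arbitrary height.  With
`φ_1(z,w) = exp(Λw/b²)·∏_j (w − z_j)^{k_j/b²}`,
`T_i(z,w) = (φ_1(z,w)/(w − z_i))·Y_i` and `F(z,w) = ∑_i T_i(z,w)`,
one has on `D = {(z,w) : w > z_1 > … > z_N}`:
`−b²·∂F/∂z_i − [(Λ/2)H_i + ∑_{j≠i} Ω_{ij}/(z_i−z_j), F]
  = (1/(w−z_i))·F∘(k_i·1 − H_i) − T_i∘(∑_j (1/(w−z_j))·(k_j·1 − H_j))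
    + b²·∂T_i/∂w`,
where the partial derivatives of the `End(V)`-valued functions are taken
coefficientwise (each `T_i` is a scalar differentiable function times the
fixed endomorphism `Y_i`).
-/

open Finset

/-- `Ω_{ab} = (1/2)·H_a H_b + X_a Y_b + Y_a X_b`. -/
noncomputable def Omega {V : Type*} [AddCommGroup V] [Module ℝ V] {N : ℕ}
    (H X Y : Fin N → Module.End ℝ V) (a b : Fin N) : Module.End ℝ V :=
  ((2 : ℝ)⁻¹) • (H a * H b) + X a * Y b + Y a * X b

/-- The master-function factor `φ_1`. -/
noncomputable def phi1 (N : ℕ) (b Λ : ℝ) (k : Fin N → ℝ)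
    (z : Fin N → ℝ) (w : ℝ) : ℝ :=
  Real.exp (Λ * w / b ^ 2) * ∏ j, (w - z j) ^ (k j / b ^ 2)

/-- `T_i(z,w) = (φ_1(z,w)/(w − z_i))·Y_i`. -/
noncomputable def Tscr {V : Type*} [AddCommGroup V] [Module ℝ V] {N : ℕ}
    (Y : Fin N → Module.End ℝ V) (b Λ : ℝ) (k : Fin N → ℝ)
    (i : Fin N) (z : Fin N → ℝ) (w : ℝ) : Module.End ℝ V :=
  (phi1 N b Λ k z w / (w - z i)) • Y i

/-- `F(z,w) = ∑_i T_i(z,w)`. -/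
noncomputable def Fscr {V : Type*} [AddCommGroup V] [Module ℝ V] {N : ℕ}
    (Y : Fin N → Module.End ℝ V) (b Λ : ℝ) (k : Fin N → ℝ)
    (z : Fin N → ℝ) (w : ℝ) : Module.End ℝ V :=
  ∑ i, Tscr Y b Λ k i z w

theorem aux_prod {N : ℕ} (s : Finset (Fin N)) (f : Fin N → ℝ → ℝ) (g : Fin N → ℝ) (x : ℝ)
    (h : ∀ j, HasDerivAt (f j) (g j * f j x) x) :
    HasDerivAt (fun t => ∏ j ∈ s, f j t) ((∑ j ∈ s, g j) * ∏ j ∈ s, f j x) x := by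
  induction s using Finset.induction_on with
  | empty => simpa using hasDerivAt_const x (1 : ℝ)
  | insert a s ha ih =>
    simp only [Finset.prod_insert ha, Finset.sum_insert ha]
    refine ((h a).mul ih).congr_deriv ?_
    ring

theorem aux_pow (x c e : ℝ) (hx : c < x) :
    HasDerivAt (fun t : ℝ => (t - c) ^ e) (e * (x - c)⁻¹ * (x - c) ^ e) x := by
  have h : 0 < x - c := sub_pos.2 hx
  have h1 := ((hasDerivAt_id x).sub_const c).rpow_const (p := e) (Or.inl h.ne')
  refine h1.congr_deriv ?_
  simp only [id]
  rw [Real.rpow_sub_one h.ne']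
  field_simp

theorem aux_pow2 (x c e : ℝ) (hx : x < c) :
    HasDerivAt (fun t : ℝ => (c - t) ^ e) (-(e * (c - x)⁻¹) * (c - x) ^ e) x := by
  have h : 0 < c - x := sub_pos.2 hx
  have h1 := ((hasDerivAt_id x).const_sub c).rpow_const (p := e) (Or.inl h.ne')
  refine h1.congr_deriv ?_
  simp only [id]
  rw [Real.rpow_sub_one h.ne']
  field_simp

theorem aux_phi_w {N : ℕ} (b Λ : ℝ) (k z : Fin N → ℝ) (w : ℝ) (hzw : ∀ j, z j < w) :
    HasDerivAt (fun t => phi1 N b Λ k z t)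
      ((Λ / b ^ 2 + ∑ j, k j / b ^ 2 * (w - z j)⁻¹) * phi1 N b Λ k z w) w := by
  unfold phi1
  have h1 : HasDerivAt (fun t : ℝ => Real.exp (Λ * t / b ^ 2))
      (Real.exp (Λ * w / b ^ 2) * (Λ * 1 / b ^ 2)) w :=
    (((hasDerivAt_id w).const_mul Λ).div_const (b ^ 2)).exp
  have h2 := aux_prod Finset.univ (fun j t => (t - z j) ^ (k j / b ^ 2)) _ w
    (fun j => aux_pow w (z j) (k j / b ^ 2) (hzw j))
  refine (h1.mul h2).congr_deriv ?_
  ring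

theorem aux_phi_z {N : ℕ} (b Λ : ℝ) (k z : Fin N → ℝ) (w : ℝ) (hzw : ∀ j, z j < w) (i : Fin N) :
    HasDerivAt (fun t => phi1 N b Λ k (Function.update z i t) w)
      (-(k i / b ^ 2 * (w - z i)⁻¹) * phi1 N b Λ k z w) (z i) := by
  unfold phi1
  have h2 := aux_prod Finset.univ (fun j t => (w - Function.update z i t j) ^ (k j / b ^ 2))
    (fun j => if j = i then -(k i / b ^ 2 * (w - z i)⁻¹) else 0) (z i) (by
      intro j
      by_cases hj : j = i
      · subst hj
        simpa using aux_pow2 (z j) w (k j / b ^ 2) (hzw j)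
      · simpa [hj] using hasDerivAt_const (z i) ((w - z j) ^ (k j / b ^ 2)))
  refine (h2.const_mul (Real.exp (Λ * w / b ^ 2))).congr_deriv ?_
  simp
  ring

theorem aux_dw {N : ℕ} (b Λ : ℝ) (k z : Fin N → ℝ) (w : ℝ) (hb : b ≠ 0)
    (hzw : ∀ j, z j < w) (i : Fin N) :
    b ^ 2 * deriv (fun t => phi1 N b Λ k z t / (t - z i)) w
      = phi1 N b Λ k z w * (w - z i)⁻¹ *
        (Λ + ∑ j, k j * (w - z j)⁻¹ - b ^ 2 * (w - z i)⁻¹) := by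
  have h : w - z i ≠ 0 := (sub_pos.2 (hzw i)).ne'
  rw [((aux_phi_w b Λ k z w hzw).fun_div ((hasDerivAt_id' w).sub_const (z i)) h).deriv]
  have e : ∑ j, k j / b ^ 2 * (w - z j)⁻¹ = (∑ j, k j * (w - z j)⁻¹) / b ^ 2 := by
    rw [Finset.sum_div]
    exact Finset.sum_congr rfl fun j _ => by ring
  rw [e]
  field_simp

theorem aux_dz {N : ℕ} (b Λ : ℝ) (k z : Fin N → ℝ) (w : ℝ) (hb : b ≠ 0)
    (hzw : ∀ j, z j < w) (i j : Fin N) :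
    -(b ^ 2) * deriv (fun t => phi1 N b Λ k (Function.update z i t) w
            / (w - Function.update z i t j)) (z i)
      = phi1 N b Λ k z w * (w - z j)⁻¹ * (k i * (w - z i)⁻¹)
        - (if j = i then b ^ 2 * (phi1 N b Λ k z w * (w - z i)⁻¹ * (w - z i)⁻¹) else 0) := by
  have h : w - z i ≠ 0 := (sub_pos.2 (hzw i)).ne'
  have h' : w - z j ≠ 0 := (sub_pos.2 (hzw j)).ne'
  have hp := aux_phi_z b Λ k z w hzw i
  by_cases hj : j = i
  · subst hj
    simp only [Function.update_self, if_true]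
    rw [(hp.fun_div ((hasDerivAt_id' (z j)).const_sub w) h).deriv]
    simp only [id, Function.update_eq_self]
    field_simp
    ring
  · simp only [Function.update_of_ne hj, if_neg hj]
    rw [(hp.div_const (w - z j)).deriv]
    field_simp
    ring

theorem aux_comm {V : Type*} [AddCommGroup V] [Module ℝ V] {N : ℕ}
    (H X Y : Fin N → Module.End ℝ V)
    (hcomm : ∀ i j, i ≠ j →
      ∀ A ∈ [H i, X i, Y i], ∀ B ∈ [H j, X j, Y j], Commute A B)
    (hHY : ∀ i, H i * Y i - Y i * H i = -(2 • Y i))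
    (hXY : ∀ i, X i * Y i - Y i * X i = H i) (c : Fin N → ℝ)
    (i j : Fin N) (hij : i ≠ j) :
    Omega H X Y i j * (∑ l, c l • Y l) - (∑ l, c l • Y l) * Omega H X Y i j
      = (c i - c j) • (Y j * H i - Y i * H j) := by
  have key : ∀ l, Omega H X Y i j * Y l - Y l * Omega H X Y i j
      = ((if l = i then (1 : ℝ) else 0) - (if l = j then 1 else 0)) •
        (Y j * H i - Y i * H j) := by
    intro l
    have cHY : ∀ a l, a ≠ l → H a * Y l = Y l * H a := fun a l h =>
      hcomm a l h _ (by simp) _ (by simp)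
    have cXY : ∀ a l, a ≠ l → X a * Y l = Y l * X a := fun a l h =>
      hcomm a l h _ (by simp) _ (by simp)
    have cYY : ∀ a l, a ≠ l → Y a * Y l = Y l * Y a := fun a l h =>
      hcomm a l h _ (by simp) _ (by simp)
    have cHH : ∀ a l, a ≠ l → H a * H l = H l * H a := fun a l h =>
      hcomm a l h _ (by simp) _ (by simp)
    have rHY : ∀ a, H a * Y a = Y a * H a - (2 : ℝ) • Y a := fun a => by
      have := hHY a
      rw [sub_eq_iff_eq_add] at this
      rw [this]; module
    have rXY : ∀ a, X a * Y a = Y a * X a + H a := fun a => by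
      have := hXY a
      rw [sub_eq_iff_eq_add] at this
      rw [this, add_comm]
    unfold Omega
    by_cases hi : l = i
    · subst hi
      have e1 : H l * H j * Y l = Y l * (H l * H j) - (2 : ℝ) • (Y l * H j) := by
        rw [mul_assoc, cHY j l hij.symm, ← mul_assoc, rHY, sub_mul, smul_mul_assoc, mul_assoc]
      have e2 : X l * Y j * Y l = Y l * (X l * Y j) + Y j * H l := by
        rw [mul_assoc, cYY j l hij.symm, ← mul_assoc, rXY, add_mul, mul_assoc, cHY l j hij]
      have e3 : Y l * X j * Y l = Y l * (Y l * X j) := by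
        rw [mul_assoc, cXY j l hij.symm]
      simp only [add_mul, mul_add, smul_mul_assoc, mul_smul_comm, e1, e2, e3, if_true, if_neg hij]
      module
    · by_cases hj : l = j
      · subst hj
        have e1 : H i * H l * Y l = Y l * (H i * H l) - (2 : ℝ) • (Y l * H i) := by
          rw [mul_assoc, rHY, mul_sub, mul_smul_comm, ← mul_assoc, cHY i l hij, mul_assoc]
        have e2 : X i * Y l * Y l = Y l * (X i * Y l) := by
          rw [cXY i l hij, mul_assoc, cXY i l hij]
        have e3 : Y i * X l * Y l = Y l * (Y i * X l) + Y i * H l := by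
          rw [mul_assoc, rXY, mul_add, ← mul_assoc, cYY i l hij, mul_assoc]
        simp only [add_mul, mul_add, smul_mul_assoc, mul_smul_comm, e1, e2, e3, if_true,
          if_neg hi]
        module
      · have e1 : H i * H j * Y l = Y l * (H i * H j) := by
          rw [mul_assoc, cHY j l (Ne.symm hj), ← mul_assoc, cHY i l (Ne.symm hi), mul_assoc]
        have e2 : X i * Y j * Y l = Y l * (X i * Y j) := by
          rw [mul_assoc, cYY j l (Ne.symm hj), ← mul_assoc, cXY i l (Ne.symm hi), mul_assoc]
        have e3 : Y i * X j * Y l = Y l * (Y i * X j) := by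
          rw [mul_assoc, cXY j l (Ne.symm hj), ← mul_assoc, cYY i l (Ne.symm hi), mul_assoc]
        simp only [add_mul, mul_add, smul_mul_assoc, mul_smul_comm, e1, e2, e3, if_neg hj,
          if_neg hi]
        module
  rw [Finset.mul_sum, Finset.sum_mul, ← Finset.sum_sub_distrib]
  simp only [mul_smul_comm, smul_mul_assoc, ← smul_sub, key, smul_smul]
  rw [← Finset.sum_smul]
  congr 1
  simp [mul_sub, Finset.sum_sub_distrib]

theorem aux_commH {V : Type*} [AddCommGroup V] [Module ℝ V] {N : ℕ}
    (H X Y : Fin N → Module.End ℝ V)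
    (hcomm : ∀ i j, i ≠ j →
      ∀ A ∈ [H i, X i, Y i], ∀ B ∈ [H j, X j, Y j], Commute A B)
    (hHY : ∀ i, H i * Y i - Y i * H i = -(2 • Y i)) (c : Fin N → ℝ) (i : Fin N) :
    H i * (∑ l, c l • Y l) - (∑ l, c l • Y l) * H i = (-2 * c i) • Y i := by
  rw [Finset.mul_sum, Finset.sum_mul, ← Finset.sum_sub_distrib]
  simp only [mul_smul_comm, smul_mul_assoc, ← smul_sub]
  rw [Finset.sum_eq_single i]
  · rw [hHY]
    module
  · intro l _ hl
    have : H i * Y l = Y l * H i := hcomm i l (Ne.symm hl) _ (by simp) _ (by simp)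
    rw [this, sub_self, smul_zero]
  · simp

theorem irregular_KZ_operator_identity
    {V : Type*} [AddCommGroup V] [Module ℝ V] {N : ℕ}
    (H X Y : Fin N → Module.End ℝ V)
    (hcomm : ∀ i j, i ≠ j →
      ∀ A ∈ [H i, X i, Y i], ∀ B ∈ [H j, X j, Y j], Commute A B)
    (hHX : ∀ i, H i * X i - X i * H i = 2 • X i)
    (hHY : ∀ i, H i * Y i - Y i * H i = -(2 • Y i))
    (hXY : ∀ i, X i * Y i - Y i * X i = H i)
    (b Λ : ℝ) (hb : b ≠ 0) (k : Fin N → ℝ)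
    (z : Fin N → ℝ) (w : ℝ) (hz : StrictAnti z) (hzw : ∀ j, z j < w)
    (i : Fin N) :
    (-(b ^ 2)) • (∑ j, (deriv (fun t =>
          phi1 N b Λ k (Function.update z i t) w
            / (w - Function.update z i t j)) (z i)) • Y j)
      - (((Λ / 2) • H i
            + ∑ j ∈ Finset.univ.erase i, (z i - z j)⁻¹ • Omega H X Y i j)
            * Fscr Y b Λ k z w
          - Fscr Y b Λ k z w
            * ((Λ / 2) • H i
              + ∑ j ∈ Finset.univ.erase i, (z i - z j)⁻¹ • Omega H X Y i j))
      = (w - z i)⁻¹ • (Fscr Y b Λ k z w * (k i • (1 : Module.End ℝ V) - H i))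
        - Tscr Y b Λ k i z w
            * (∑ j, (w - z j)⁻¹ • (k j • (1 : Module.End ℝ V) - H j))
        + (b ^ 2) • ((deriv (fun t => phi1 N b Λ k z t / (t - z i)) w)
            • Y i) := by
  have hF : Fscr Y b Λ k z w = ∑ l, (phi1 N b Λ k z w * (w - z l)⁻¹) • Y l := by
    simp only [Fscr, Tscr, div_eq_mul_inv]
  have hT : Tscr Y b Λ k i z w = (phi1 N b Λ k z w * (w - z i)⁻¹) • Y i := by
    simp only [Tscr, div_eq_mul_inv]
  have hC := aux_comm H X Y hcomm hHY hXY (fun l => phi1 N b Λ k z w * (w - z l)⁻¹) i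
  have hCH := aux_commH H X Y hcomm hHY (fun l => phi1 N b Λ k z w * (w - z l)⁻¹) i
  rw [Finset.smul_sum]
  simp only [smul_smul, aux_dz b Λ k z w hb hzw, aux_dw b Λ k z w hb hzw]
  rw [hT]
  simp only [← hF] at hC hCH
  have hbr : (((Λ / 2) • H i
            + ∑ j ∈ Finset.univ.erase i, (z i - z j)⁻¹ • Omega H X Y i j)
            * Fscr Y b Λ k z w
          - Fscr Y b Λ k z w
            * ((Λ / 2) • H i
              + ∑ j ∈ Finset.univ.erase i, (z i - z j)⁻¹ • Omega H X Y i j))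
      = (-Λ * (phi1 N b Λ k z w * (w - z i)⁻¹)) • Y i
        + ∑ j, (phi1 N b Λ k z w * (w - z i)⁻¹ * (w - z j)⁻¹) • (Y j * H i - Y i * H j) := by
    rw [add_mul, mul_add, add_sub_add_comm, smul_mul_assoc, mul_smul_comm, ← smul_sub, hCH,
      smul_smul, Finset.mul_sum, Finset.sum_mul, ← Finset.sum_sub_distrib]
    congr 1
    · congr 1
      ring
    · rw [← Finset.add_sum_erase Finset.univ _ (Finset.mem_univ i), sub_self, smul_zero, zero_add]
      refine Finset.sum_congr rfl fun j hj => ?_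
      have hij : i ≠ j := (Finset.ne_of_mem_erase hj).symm
      rw [smul_mul_assoc, mul_smul_comm, ← smul_sub, hC j hij, smul_smul]
      congr 1
      have h1 : w - z i ≠ 0 := (sub_pos.2 (hzw i)).ne'
      have h2 : w - z j ≠ 0 := (sub_pos.2 (hzw j)).ne'
      have h3 : z i - z j ≠ 0 := sub_ne_zero.2 (hz.injective.ne hij)
      field_simp
      ring
  rw [hbr, hF]
  generalize phi1 N b Λ k z w = p
  have e1 : ∑ j, (p * (w - z j)⁻¹ * (k i * (w - z i)⁻¹)
        - (if j = i then b ^ 2 * (p * (w - z i)⁻¹ * (w - z i)⁻¹) else 0)) • Y j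
      = ∑ j, (p * (w - z j)⁻¹ * (k i * (w - z i)⁻¹)) • Y j
        - (b ^ 2 * (p * (w - z i)⁻¹ * (w - z i)⁻¹)) • Y i := by
    simp only [sub_smul, Finset.sum_sub_distrib, ite_smul, zero_smul, Finset.sum_ite_eq',
      Finset.mem_univ, if_true]
  rw [e1]
  have e2 : (p * (w - z i)⁻¹ * (Λ + ∑ j, k j * (w - z j)⁻¹ - b ^ 2 * (w - z i)⁻¹)) • Y i
      = (p * (w - z i)⁻¹ * Λ - b ^ 2 * (p * (w - z i)⁻¹ * (w - z i)⁻¹)) • Y i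
        + ∑ j, (p * (w - z i)⁻¹ * (k j * (w - z j)⁻¹)) • Y i := by
    rw [← Finset.sum_smul, ← Finset.mul_sum]
    module
  rw [e2, Finset.sum_mul, Finset.smul_sum, Finset.mul_sum]
  have e3 : ∑ j, (p * (w - z j)⁻¹ * (k i * (w - z i)⁻¹)) • Y j
      - ∑ j, (p * (w - z i)⁻¹ * (w - z j)⁻¹) • (Y j * H i - Y i * H j)
      = ∑ j, (w - z i)⁻¹ • ((p * (w - z j)⁻¹) • Y j * (k i • (1 : Module.End ℝ V) - H i))
        - ∑ j, (p * (w - z i)⁻¹) • Y i * ((w - z j)⁻¹ • (k j • (1 : Module.End ℝ V) - H j))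
        + ∑ j, (p * (w - z i)⁻¹ * (k j * (w - z j)⁻¹)) • Y i := by
    rw [← Finset.sum_sub_distrib, ← Finset.sum_sub_distrib, ← Finset.sum_add_distrib]
    refine Finset.sum_congr rfl fun j _ => ?_
    simp only [mul_sub, smul_mul_assoc, mul_smul_comm, mul_one]
    module
  rw [add_left_comm, ← e3]
  module
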